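/- arXiv:1001.4400 — 5 statements merged into one kernel-verified Lean document; each statement's English description precedes it below -/
import Mathlib

section
/- The algebras S^n_ω and S^n_{ω'} are isomorphic as graded algebras — that is, there exists a ℂ-algebra isomorphism Ψ : S^n_ω → S^n_{ω'} mapping the linear span of the generators X_1,…,X_n onto the linear span of the generators X_1,…,X_n — if and only if there exists a permutation σ ∈ Σ_n such that ω'_{σ(i)σ(j)} = ω_{ij} for all i, j ∈ {1,…,n}. -/
noncomputable section

/-- The defining relations of the skew polynomial algebra `S^n_ω`:
`X_j * X_i = ω_{ij} • (X_i * X_j)`. -/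
def srel (n : ℕ) (ω : Fin n → Fin n → ℂ) :
    FreeAlgebra ℂ (Fin n) → FreeAlgebra ℂ (Fin n) → Prop := fun a b =>
  ∃ i j : Fin n,
    a = FreeAlgebra.ι ℂ j * FreeAlgebra.ι ℂ i ∧
    b = ω i j • (FreeAlgebra.ι ℂ i * FreeAlgebra.ι ℂ j)

/-- The skew polynomial algebra `S^n_ω`. -/
abbrev Somega (n : ℕ) (ω : Fin n → Fin n → ℂ) := RingQuot (srel n ω)

/-- The image of the generator `X_i` in `S^n_ω`. -/
def Xgen (n : ℕ) (ω : Fin n → Fin n → ℂ) (i : Fin n) : Somega n ω :=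
  RingQuot.mkAlgHom ℂ (srel n ω) (FreeAlgebra.ι ℂ i)

theorem Xgen_mul_Xgen {n : ℕ} (ω : Fin n → Fin n → ℂ) (i j : Fin n) :
    Xgen n ω j * Xgen n ω i = ω i j • (Xgen n ω i * Xgen n ω j) := by
  have h := RingQuot.mkAlgHom_rel ℂ (s := srel n ω) ⟨i, j, rfl, rfl⟩
  simpa [Xgen] using h

/-- The universal property of `S^n_ω`. -/
def Somega.lift {n : ℕ} {B : Type*} [Ring B] [Algebra ℂ B] (ω : Fin n → Fin n → ℂ)
    (x : Fin n → B) (hx : ∀ i j, x j * x i = ω i j • (x i * x j)) : Somega n ω →ₐ[ℂ] B :=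
  RingQuot.liftAlgHom ℂ ⟨FreeAlgebra.lift ℂ x, by
    rintro _ _ ⟨i, j, rfl, rfl⟩
    simpa using hx i j⟩

theorem Somega.lift_Xgen {n : ℕ} {B : Type*} [Ring B] [Algebra ℂ B] (ω : Fin n → Fin n → ℂ)
    (x : Fin n → B) (hx : ∀ i j, x j * x i = ω i j • (x i * x j)) (i : Fin n) :
    Somega.lift ω x hx (Xgen n ω i) = x i := by
  simp [Somega.lift, Xgen]

theorem Somega.hom_ext {n : ℕ} {B : Type*} [Ring B] [Algebra ℂ B] {ω : Fin n → Fin n → ℂ}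
    {f g : Somega n ω →ₐ[ℂ] B} (h : ∀ i, f (Xgen n ω i) = g (Xgen n ω i)) : f = g := by
  apply RingQuot.ringQuot_ext'
  apply FreeAlgebra.hom_ext
  funext i
  exact h i

/-- The action of the generator `X_p` on the truncation `ℂ ⊕ ℂⁿ ⊕ ℂ` in which the product of
the generators `X_p X_q` is `c p q` times the top-degree basis vector. -/
def truncatedAction {n : ℕ} (c : Fin n → Fin n → ℂ) (p : Fin n) :
    Module.End ℂ (ℂ × (Fin n → ℂ) × ℂ) where
  toFun v := (0, v.1 • Pi.single p 1, ∑ q, c p q * v.2.1 q)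
  map_add' v w := by simp [add_smul, mul_add, Finset.sum_add_distrib]
  map_smul' r v := by simp [mul_smul, Finset.mul_sum, mul_left_comm]

theorem truncatedAction_mul {n : ℕ} (c : Fin n → Fin n → ℂ) (p q : Fin n)
    (v : ℂ × (Fin n → ℂ) × ℂ) :
    (truncatedAction c p * truncatedAction c q) v = (0, 0, v.1 * c p q) := by
  simp [truncatedAction, Pi.single_apply, mul_comm]

theorem exists_truncation {n : ℕ} {ω c : Fin n → Fin n → ℂ}
    (hc : ∀ p q, c q p = ω p q * c p q) :
    ∃ ρ : Somega n ω →ₐ[ℂ] Module.End ℂ (ℂ × (Fin n → ℂ) × ℂ),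
      ∀ p, ρ (Xgen n ω p) = truncatedAction c p := by
  refine ⟨Somega.lift ω (truncatedAction c) fun i j => ?_, Somega.lift_Xgen _ _ _⟩
  refine LinearMap.ext fun v => ?_
  rw [LinearMap.smul_apply, truncatedAction_mul, truncatedAction_mul, hc i j]
  simp [mul_left_comm]

theorem exists_quadratic_functional {n : ℕ} {ω c : Fin n → Fin n → ℂ}
    (hc : ∀ p q, c q p = ω p q * c p q) :
    ∃ f : Somega n ω →ₗ[ℂ] ℂ, ∀ p q, f (Xgen n ω p * Xgen n ω q) = c p q := by
  obtain ⟨ρ, hρ⟩ := exists_truncation hc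
  refine ⟨(LinearMap.snd ℂ _ _ ∘ₗ LinearMap.snd ℂ _ _) ∘ₗ
    LinearMap.applyₗ (1, 0, 0) ∘ₗ ρ.toLinearMap, fun p q => ?_⟩
  have h := truncatedAction_mul c p q (1, 0, 0)
  simp only [LinearMap.comp_apply, AlgHom.toLinearMap_apply, map_mul, hρ,
    LinearMap.applyₗ_apply_apply, h]
  simp

theorem linearIndependent_Xgen {n : ℕ} (ω : Fin n → Fin n → ℂ) :
    LinearIndependent ℂ (Xgen n ω) := by
  obtain ⟨ρ, hρ⟩ := exists_truncation (ω := ω) (c := 0) (by simp)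
  refine LinearIndependent.of_comp ((LinearMap.fst ℂ _ _ ∘ₗ LinearMap.snd ℂ _ _) ∘ₗ
    LinearMap.applyₗ (1, 0, 0) ∘ₗ ρ.toLinearMap) ?_
  convert (Pi.basisFun ℂ (Fin n)).linearIndependent using 1
  funext p
  simp [hρ, truncatedAction]

/-- The equations satisfied by the coefficient matrix `a` of a homomorphism
`S^n_ω → S^n_{ω'}` that sends generators to linear combinations of generators. -/
def IsLinearSubstitution {n : ℕ} (ω ω' a : Fin n → Fin n → ℂ) : Prop :=
  ∀ i j k l, a j k * a i l * (1 - ω i j * ω' k l) = a i k * a j l * (ω i j - ω' k l)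

theorem isLinearSubstitution_of_hom {n : ℕ} {ω ω' a : Fin n → Fin n → ℂ}
    (hω' : ∀ i j, ω' i j * ω' j i = 1) (Ψ : Somega n ω →ₐ[ℂ] Somega n ω')
    (ha : ∀ i, Ψ (Xgen n ω i) = ∑ k, a i k • Xgen n ω' k) : IsLinearSubstitution ω ω' a := by
  intro i j k l
  obtain ⟨f, hf⟩ := exists_quadratic_functional (ω := ω')
    (c := fun p q => (if p = k then 1 else 0) * (if q = l then 1 else 0) +
      ω' k l * ((if p = l then 1 else 0) * (if q = k then 1 else 0))) (by
        intro p q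
        have h := hω' k l
        by_cases h1 : p = k <;> by_cases h2 : q = l <;> by_cases h3 : p = l <;>
          by_cases h4 : q = k <;> simp [h1, h2, h3, h4] <;> grind)
  have key : ∀ u v, f (Ψ (Xgen n ω u * Xgen n ω v)) =
      a u k * a v l + ω' k l * (a u l * a v k) := by
    intro u v
    rw [map_mul, ha, ha, Finset.sum_mul_sum]
    simp only [smul_mul_smul_comm, map_sum, map_smul, hf, smul_eq_mul, mul_add,
      Finset.sum_add_distrib]
    simp
    ring
  have h := congrArg (fun x => f (Ψ x)) (Xgen_mul_Xgen ω i j)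
  simp only [map_smul, key, smul_eq_mul] at h
  linear_combination h

theorem exists_perm_forall_ne_zero {n : ℕ} {A : Matrix (Fin n) (Fin n) ℂ} (hA : A.det ≠ 0) :
    ∃ σ : Equiv.Perm (Fin n), ∀ i, A i (σ i) ≠ 0 := by
  rw [← Matrix.det_transpose, Matrix.det_apply] at hA
  obtain ⟨σ, -, hσ⟩ := Finset.exists_ne_zero_of_sum_ne_zero hA
  refine ⟨σ, fun i hi => hσ ?_⟩
  rw [Finset.prod_eq_zero (Finset.mem_univ i) (by simpa using hi), smul_zero]

theorem exists_minor_ne_zero_of_columns {n : ℕ} {A : Matrix (Fin n) (Fin n) ℂ} (hA : A.det ≠ 0)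
    {k l : Fin n} (hkl : k ≠ l) {i : Fin n} (hi : A i k ≠ 0) :
    ∃ p, A i k * A p l ≠ A i l * A p k := by
  by_contra! h
  refine hA (Matrix.exists_mulVec_eq_zero_iff.mp
    ⟨Pi.single l (A i k) - Pi.single k (A i l), fun h0 => hi ?_, ?_⟩)
  · simpa [hkl.symm] using congrFun h0 l
  · funext p
    simp only [Matrix.mulVec_sub, Matrix.mulVec_single, Pi.sub_apply, Pi.smul_apply,
      MulOpposite.smul_eq_mul_unop, MulOpposite.unop_op, Matrix.col_apply, Pi.zero_apply]
    linear_combination h p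

theorem IsLinearSubstitution.diag {n : ℕ} {ω ω' a : Fin n → Fin n → ℂ}
    (h : IsLinearSubstitution ω ω' a) {i k : Fin n} (ha : a i k ≠ 0) (hk : ω' k k = 1) :
    ω i i = 1 := by
  have h0 := h i i k k
  rw [hk] at h0
  have h1 : a i k * a i k ≠ 0 := mul_ne_zero ha ha
  have : a i k * a i k * (ω i i - 1) = 0 := by linear_combination -h0 / 2
  grind

theorem IsLinearSubstitution.eq_one_of_column {n : ℕ} {ω ω' a : Fin n → Fin n → ℂ}
    (h : IsLinearSubstitution ω ω' a) {i j k : Fin n} (hi : a i k ≠ 0) (hj : a j k ≠ 0)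
    (hk : ω' k k = 1) : ω i j = 1 := by
  have h0 := h i j k k
  rw [hk] at h0
  have h1 : a i k * a j k ≠ 0 := mul_ne_zero hi hj
  have : a i k * a j k * (ω i j - 1) = 0 := by linear_combination -h0 / 2
  grind

theorem IsLinearSubstitution.eq_neg_one_of_row {n : ℕ} {ω ω' a : Fin n → Fin n → ℂ}
    (h : IsLinearSubstitution ω ω' a) {i k l : Fin n} (hk : a i k ≠ 0) (hl : a i l ≠ 0)
    (hi : ω i i = -1) : ω' k l = -1 := by
  have h0 := h i i k l
  rw [hi] at h0
  have h1 : a i k * a i l ≠ 0 := mul_ne_zero hk hl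
  have : a i k * a i l * (ω' k l + 1) = 0 := by linear_combination h0 / 2
  grind

/-- A row of an invertible substitution cannot mix two noncommuting generators of square
nonzero. -/
theorem IsLinearSubstitution.commute_of_row {n : ℕ} {ω ω' : Fin n → Fin n → ℂ}
    {A : Matrix (Fin n) (Fin n) ℂ} (h : IsLinearSubstitution ω ω' A) (hA : A.det ≠ 0)
    {i k l : Fin n} (hik : A i k ≠ 0) (hil : A i l ≠ 0) (hk : ω' k k = 1) (hl : ω' l l = 1) :
    ω' k l = 1 := by
  by_contra hkl
  obtain ⟨p, hp⟩ := exists_minor_ne_zero_of_columns hA (by grind : k ≠ l) hik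
  have hip : ω i p ≠ 1 := by
    intro h1
    have h0 := h i p k l
    rw [h1] at h0
    have : (1 - ω' k l) * (A i k * A p l - A i l * A p k) = 0 := by linear_combination -h0
    grind
  have h1 : A p k = 0 := by
    by_contra h1
    exact hip (h.eq_one_of_column hik h1 hk)
  have h2 : A p l = 0 := by
    by_contra h2
    exact hip (h.eq_one_of_column hil h2 hl)
  exact hp (by rw [h1, h2, mul_zero, mul_zero])

/-- A column of an invertible substitution cannot mix two generators of square zero that do not
anticommute. -/
theorem IsLinearSubstitution.anticommute_of_column {n : ℕ} {ω ω' : Fin n → Fin n → ℂ}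
    {A : Matrix (Fin n) (Fin n) ℂ} (h : IsLinearSubstitution ω ω' A) (hA : A.det ≠ 0)
    {i j k : Fin n} (hik : A i k ≠ 0) (hjk : A j k ≠ 0) (hi : ω i i = -1) (hj : ω j j = -1) :
    ω i j = -1 := by
  by_contra hij
  obtain ⟨p, hp⟩ := exists_minor_ne_zero_of_columns (A := A.transpose)
    (by rwa [Matrix.det_transpose]) (by grind : i ≠ j) (i := k) hik
  simp only [Matrix.transpose_apply] at hp
  have hkp : ω' k p ≠ -1 := by
    intro h1
    have h0 := h i j k p
    rw [h1] at h0
    have : (1 + ω i j) * (A i k * A j p - A j k * A i p) = 0 := by linear_combination -h0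
    grind
  have h1 : A i p = 0 := by
    by_contra h1
    exact hkp (h.eq_neg_one_of_row hik h1 hi)
  have h2 : A j p = 0 := by
    by_contra h2
    exact hkp (h.eq_neg_one_of_row hjk h2 hj)
  exact hp (by rw [h1, h2, mul_zero, mul_zero])

theorem IsLinearSubstitution.eq_of_ne_zero {n : ℕ} {ω ω' : Fin n → Fin n → ℂ}
    {A : Matrix (Fin n) (Fin n) ℂ} (h : IsLinearSubstitution ω ω' A) (hA : A.det ≠ 0)
    (hω : ∀ i, ω i i = 1 ∨ ω i i = -1) {i j k l : Fin n} (hik : A i k ≠ 0) (hjl : A j l ≠ 0)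
    (hi : ω i i = ω' k k) (hj : ω j j = ω' l l) : ω' k l = ω i j := by
  by_contra hne
  have h0 := h i j k l
  have hmul : A j k * A i l ≠ 0 := by
    intro h1
    rw [h1, zero_mul] at h0
    have := mul_ne_zero hik hjl
    grind
  have hjk := left_ne_zero_of_mul hmul
  have hil := right_ne_zero_of_mul hmul
  rcases hω i with hi1 | hi1
  · have hk1 := hi ▸ hi1
    have hj1 := h.diag hjk hk1
    exact hne ((h.commute_of_row hA hik hil hk1 (hj ▸ hj1)).trans
      (h.eq_one_of_column hik hjk hk1).symm)
  · rcases hω j with hj1 | hj1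
    · have := h.diag hil (hj ▸ hj1)
      norm_num [hi1] at this
    · exact hne ((h.eq_neg_one_of_row hik hil hi1).trans
        (h.anticommute_of_column hA hik hjk hi1 hj1).symm)

theorem forall_iff_of_perm_imp {α : Type*} [Fintype α] {P Q : α → Prop} (σ τ : Equiv.Perm α)
    (h : ∀ i, Q (σ i) → P i) (h' : ∀ k, P (τ k) → Q k) (i : α) : Q (σ i) ↔ P i := by
  classical
  refine ⟨h i, fun hi => ?_⟩
  have hsub : (Finset.univ.filter Q).map σ.symm.toEmbedding ⊆ Finset.univ.filter P := by
    intro j hj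
    simp only [Finset.mem_map, Finset.mem_filter, Finset.mem_univ, true_and] at hj
    obtain ⟨k, hk, rfl⟩ := hj
    simpa using h (σ.symm k) (by simpa using hk)
  have hsub' : (Finset.univ.filter P).map τ.symm.toEmbedding ⊆ Finset.univ.filter Q := by
    intro j hj
    simp only [Finset.mem_map, Finset.mem_filter, Finset.mem_univ, true_and] at hj
    obtain ⟨k, hk, rfl⟩ := hj
    simpa using h' (τ.symm k) (by simpa using hk)
  have heq := Finset.eq_of_subset_of_card_le hsub (by
    simpa using Finset.card_le_card hsub')
  have hmem : i ∈ (Finset.univ.filter Q).map σ.symm.toEmbedding := by simpa [heq] using hi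
  simp only [Finset.mem_map, Finset.mem_filter, Finset.mem_univ, true_and] at hmem
  obtain ⟨k, hk, rfl⟩ := hmem
  simpa using hk

theorem exists_perm_of_linear_iso {n : ℕ} {ω ω' : Fin n → Fin n → ℂ}
    (hω : ∀ i j, ω i j * ω j i = 1) (hω' : ∀ i j, ω' i j * ω' j i = 1)
    (Ψ : Somega n ω ≃ₐ[ℂ] Somega n ω')
    (hΨ : Submodule.map Ψ.toLinearMap (Submodule.span ℂ (Set.range (Xgen n ω))) =
      Submodule.span ℂ (Set.range (Xgen n ω'))) :
    ∃ σ : Equiv.Perm (Fin n), ∀ i j, ω' (σ i) (σ j) = ω i j := by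
  have hX : ∀ i, ∃ a : Fin n → ℂ, ∑ k, a k • Xgen n ω' k = Ψ (Xgen n ω i) := by
    intro i
    rw [← Submodule.mem_span_range_iff_exists_fun, ← hΨ]
    exact Submodule.mem_map_of_mem (Submodule.subset_span ⟨i, rfl⟩)
  have hX' : ∀ k, ∃ b : Fin n → ℂ, ∑ i, b i • Xgen n ω i = Ψ.symm (Xgen n ω' k) := by
    intro k
    have hk : Xgen n ω' k ∈ Submodule.span ℂ (Set.range (Xgen n ω')) :=
      Submodule.subset_span ⟨k, rfl⟩
    rw [← hΨ] at hk
    obtain ⟨x, hx, hxk⟩ := hk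
    rw [← Submodule.mem_span_range_iff_exists_fun, ← hxk]
    simpa using hx
  choose A hA using hX
  choose B hB using hX'
  have hAB : Matrix.of A * Matrix.of B = 1 := by
    funext i
    refine (linearIndependent_Xgen ω).fintypeLinearCombination_injective ?_
    simp only [Fintype.linearCombination_apply, Matrix.mul_apply, Matrix.of_apply,
      Finset.sum_smul, Matrix.one_apply, ite_smul, one_smul, zero_smul, Finset.sum_ite_eq,
      Finset.mem_univ, if_true]
    rw [Finset.sum_comm]
    simp only [mul_smul, ← Finset.smul_sum, hB]
    simpa using congrArg Ψ.symm (hA i)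
  have hdet : (Matrix.of A).det * (Matrix.of B).det = 1 := by
    rw [← Matrix.det_mul, hAB, Matrix.det_one]
  have hdetA := left_ne_zero_of_mul_eq_one hdet
  have hdetB := right_ne_zero_of_mul_eq_one hdet
  have hsA : IsLinearSubstitution ω ω' (Matrix.of A) :=
    isLinearSubstitution_of_hom hω' Ψ.toAlgHom fun i => (hA i).symm
  have hsB : IsLinearSubstitution ω' ω (Matrix.of B) :=
    isLinearSubstitution_of_hom hω Ψ.symm.toAlgHom fun i => (hB i).symm
  obtain ⟨σ, hσ⟩ := exists_perm_forall_ne_zero hdetA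
  obtain ⟨τ, hτ⟩ := exists_perm_forall_ne_zero hdetB
  have hd : ∀ i, ω i i = 1 ∨ ω i i = -1 := fun i => mul_self_eq_one_iff.mp (hω i i)
  have hd' : ∀ i, ω' i i = 1 ∨ ω' i i = -1 := fun i => mul_self_eq_one_iff.mp (hω' i i)
  have hsign := forall_iff_of_perm_imp (P := fun i => ω i i = 1) (Q := fun k => ω' k k = 1) σ τ
    (fun i => hsA.diag (hσ i)) (fun k => hsB.diag (hτ k))
  have hdiag : ∀ i, ω i i = ω' (σ i) (σ i) := by
    intro i
    have h1 := hsign i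
    have h2 := hd i
    have h3 := hd' (σ i)
    grind
  exact ⟨σ, fun i j => hsA.eq_of_ne_zero hdetA hd (hσ i) (hσ j) (hdiag i) (hdiag j)⟩

/-- Permuting the generators as an algebra isomorphism. -/
def Somega.permEquiv {n : ℕ} {ω ω' : Fin n → Fin n → ℂ} (σ : Equiv.Perm (Fin n))
    (h : ∀ i j, ω' (σ i) (σ j) = ω i j) : Somega n ω ≃ₐ[ℂ] Somega n ω' :=
  AlgEquiv.ofAlgHom
    (Somega.lift ω (fun i => Xgen n ω' (σ i)) fun i j => by rw [Xgen_mul_Xgen, h])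
    (Somega.lift ω' (fun i => Xgen n ω (σ.symm i)) fun i j => by
      rw [Xgen_mul_Xgen, ← h, σ.apply_symm_apply, σ.apply_symm_apply])
    (Somega.hom_ext fun i => by simp [Somega.lift_Xgen])
    (Somega.hom_ext fun i => by simp [Somega.lift_Xgen])

theorem Somega.permEquiv_Xgen {n : ℕ} {ω ω' : Fin n → Fin n → ℂ} (σ : Equiv.Perm (Fin n))
    (h : ∀ i j, ω' (σ i) (σ j) = ω i j) (i : Fin n) :
    Somega.permEquiv σ h (Xgen n ω i) = Xgen n ω' (σ i) :=
  Somega.lift_Xgen _ _ _ i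

/-- `S^n_ω ≅ S^n_{ω'}` as graded algebras (i.e. via a `ℂ`-algebra isomorphism carrying
the span of the generators onto the span of the generators) iff there is a permutation
`σ` with `ω'_{σ(i)σ(j)} = ω_{ij}` for all `i, j`. -/
theorem graded_iso_iff_perm {n : ℕ} (hn : 1 ≤ n) (ω ω' : Fin n → Fin n → ℂ)
    (hω0 : ∀ i j, ω i j ≠ 0) (hω'0 : ∀ i j, ω' i j ≠ 0)
    (hω1 : ∀ i j, ω i j * ω j i = 1) (hω'1 : ∀ i j, ω' i j * ω' j i = 1) :
    (∃ Ψ : Somega n ω ≃ₐ[ℂ] Somega n ω',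
        Submodule.map Ψ.toLinearMap (Submodule.span ℂ (Set.range (Xgen n ω))) =
          Submodule.span ℂ (Set.range (Xgen n ω'))) ↔
      ∃ σ : Equiv.Perm (Fin n), ∀ i j, ω' (σ i) (σ j) = ω i j := by
  constructor
  · rintro ⟨Ψ, hΨ⟩
    exact exists_perm_of_linear_iso hω1 hω'1 Ψ hΨ
  · rintro ⟨σ, hσ⟩
    refine ⟨Somega.permEquiv σ hσ, ?_⟩
    rw [Submodule.map_span, ← Set.range_comp]
    have hcomp : (Somega.permEquiv σ hσ).toLinearMap ∘ Xgen n ω = Xgen n ω' ∘ σ :=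
      funext fun i => Somega.permEquiv_Xgen σ hσ i
    rw [hcomp, σ.surjective.range_comp]
end
end

section
/- Let τ = (a_1 a_2 … a_k) be a k-cycle in Σ_n with k < n and let b ∈ {1,…,n} be fixed by τ (i.e., b ∉ {a_1,…,a_k}). Then q_τ(ω) = (∏_{i=1}^{k-1} q_{(b a_i a_{i+1})}(ω)) · q_{(b a_k a_1)}(ω), where (b a c) denotes the 3-cycle sending b ↦ a ↦ c ↦ b. -/
open scoped BigOperators

/-- The `τ`-cyclic `q`-number `q_τ(ω) = ∏_{i=1}^{k} ω_{τ^{i-1}(v) τ^{i}(v)}`,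
where `k` is the length of the cycle `τ` and `v` is a point not fixed by `τ`. -/
def qnum {n : ℕ} (ω : Fin n → Fin n → ℂ) (τ : Equiv.Perm (Fin n)) (v : Fin n) : ℂ :=
  ∏ i ∈ Finset.range τ.support.card, ω ((τ ^ i) v) ((τ ^ (i + 1)) v)

/-- The cyclic `q`-number of a 3-cycle `(a b c)`: `q_{(abc)}(ω) = ω_{ab} ω_{bc} ω_{ca}`. -/
def q3 {n : ℕ} (ω : Fin n → Fin n → ℂ) (a b c : Fin n) : ℂ :=
  ω a b * ω b c * ω c a

theorem formPerm_map_range_pow_apply_zero {α : Type*} [DecidableEq α] {k : ℕ} (hk : 0 < k)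
    {a : ℕ → α} (hl : ((List.range k).map a).Nodup) (i : ℕ) :
    (((List.range k).map a).formPerm ^ i) (a 0) = a (i % k) := by
  have h := List.formPerm_pow_apply_getElem _ hl i 0 (by simpa using hk)
  simpa using h

theorem support_formPerm_map_range_card {α : Type*} [DecidableEq α] [Fintype α] {k : ℕ}
    (hk : 2 ≤ k) {a : ℕ → α} (hl : ((List.range k).map a).Nodup) :
    ((List.range k).map a).formPerm.support.card = k := by
  rw [List.support_formPerm_of_nodup _ hl, List.toFinset_card_of_nodup hl]
  · simp
  · intro x hx
    have := congrArg List.length hx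
    simp at this
    omega

/-- The product of the 3-cycle numbers along an open path telescopes. -/
theorem prod_range_q3 {n : ℕ} {ω : Fin n → Fin n → ℂ} (hω : ∀ i j, ω i j * ω j i = 1)
    (a : ℕ → Fin n) (b : Fin n) (m : ℕ) :
    ∏ i ∈ Finset.range m, q3 ω b (a i) (a (i + 1)) =
      (∏ i ∈ Finset.range m, ω (a i) (a (i + 1))) * (ω b (a 0) * ω (a m) b) := by
  induction m with
  | zero => simp [hω]
  | succ m ih =>
    rw [Finset.prod_range_succ, Finset.prod_range_succ, ih, q3]
    linear_combination (∏ i ∈ Finset.range m, ω (a i) (a (i + 1))) * ω (a m) (a (m + 1)) *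
      ω b (a 0) * ω (a (m + 1)) b * hω (a m) b

/-- For a `k`-cycle `τ = (a_1 a_2 … a_k)` with `k < n` and `b` fixed by `τ`,
`q_τ(ω) = (∏_{i=1}^{k-1} q_{(b a_i a_{i+1})}(ω)) ⬝ q_{(b a_k a_1)}(ω)`.
(Here `a_1, …, a_k` are `a 0, …, a (k-1)`, and the cycle is `((List.range k).map a).formPerm`.) -/
theorem qnum_eq_prod_q3_of_fixed {n k : ℕ} (hk : 2 ≤ k) (hkn : k < n)
    (ω : Fin n → Fin n → ℂ)
    (hω0 : ∀ i j, ω i j ≠ 0) (hω1 : ∀ i j, ω i j * ω j i = 1)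
    (a : ℕ → Fin n) (ha : ∀ i j, i < k → j < k → a i = a j → i = j)
    (b : Fin n) (hb : ∀ i, i < k → b ≠ a i) :
    qnum ω ((List.range k).map a).formPerm (a 0) =
      (∏ i ∈ Finset.range (k - 1), q3 ω b (a i) (a (i + 1))) *
        q3 ω b (a (k - 1)) (a 0) := by
  have hl : ((List.range k).map a).Nodup :=
    List.nodup_range.map_on fun x hx y hy h =>
      ha x y (List.mem_range.1 hx) (List.mem_range.1 hy) h
  obtain ⟨m, rfl⟩ : ∃ m, k = m + 1 := ⟨k - 1, by omega⟩
  have hcyc : qnum ω ((List.range (m + 1)).map a).formPerm (a 0) =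
      (∏ i ∈ Finset.range m, ω (a i) (a (i + 1))) * ω (a m) (a 0) := by
    rw [qnum, support_formPerm_map_range_card hk hl, Finset.prod_range_succ]
    simp only [formPerm_map_range_pow_apply_zero m.succ_pos hl]
    congr 1
    · refine Finset.prod_congr rfl fun i hi => ?_
      have := Finset.mem_range.1 hi
      rw [Nat.mod_eq_of_lt (by omega : i < m + 1), Nat.mod_eq_of_lt (by omega : i + 1 < m + 1)]
    · rw [Nat.mod_self, Nat.mod_eq_of_lt m.lt_succ_self]
  rw [hcyc, Nat.add_sub_cancel, prod_range_q3 hω1, q3]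
  linear_combination (-(∏ i ∈ Finset.range m, ω (a i) (a (i + 1))) * ω (a m) (a 0)) *
    (ω b (a 0) * ω (a 0) b * hω1 (a m) b + hω1 b (a 0))
end

section
/- For every family ω of parameters there exist nonzero complex numbers a_1,…,a_n such that the family ω̃ defined by ω̃_{ij} := a_i a_j^{-1} ω_{ij} is non-repetitive, i.e., ω̃_{ij} ≠ ω̃_{kl} whenever 1 ≤ i < j ≤ n, 1 ≤ k < l ≤ n and (i,j) ≠ (k,l). (Note that ω̃ again satisfies ω̃_{ij}ω̃_{ji} = 1 for all i, j.) -/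
open MvPolynomial in
/-- A binomial difference of two distinct quadratic monomials is a nonzero polynomial. -/
theorem MvPolynomial.C_mul_X_mul_X_sub_ne_zero {σ R : Type*} [CommRing R] {i j k l : σ} {c d : R}
    (hc : c ≠ 0) (hij : i ≠ j) (h : i = k → l ≠ j) :
    (C c * (X i * X l) - C d * (X k * X j) : MvPolynomial σ R) ≠ 0 := by
  classical
  have hne : (Finsupp.single k 1 + Finsupp.single j 1 : σ →₀ ℕ) ≠
      Finsupp.single i 1 + Finsupp.single l 1 := by
    intro he
    have hik : k = i := by
      by_contra hki
      have := DFunLike.congr_fun he i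
      simp [Finsupp.single_apply, hki, hij.symm] at this
      omega
    subst hik
    exact h rfl (Finsupp.single_left_injective one_ne_zero (add_left_cancel he)).symm
  intro h0
  have hcoeff := congrArg (coeff (Finsupp.single i 1 + Finsupp.single l 1)) h0
  simp only [X, monomial_mul, coeff_sub, coeff_C_mul, coeff_monomial, if_neg hne] at hcoeff
  simp [hc] at hcoeff

/-- For every family `ω` of parameters there are nonzero complex numbers `a_1, …, a_n`
such that the twisted family `ω̃_{ij} = a_i a_j⁻¹ ω_{ij}` is non-repetitive. -/
theorem exists_nonrepetitive_twist {n : ℕ} (ω : Fin n → Fin n → ℂ)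
    (hω0 : ∀ i j, ω i j ≠ 0) (hω1 : ∀ i j, ω i j * ω j i = 1) :
    ∃ a : Fin n → ℂ, (∀ i, a i ≠ 0) ∧
      ∀ i j k l : Fin n, i < j → k < l → (i, j) ≠ (k, l) →
        a i * (a j)⁻¹ * ω i j ≠ a k * (a l)⁻¹ * ω k l := by
  classical
  let S : Finset ((Fin n × Fin n) × (Fin n × Fin n)) :=
    Finset.univ.filter fun q => q.1.1 < q.1.2 ∧ q.1 ≠ q.2
  let P : (Fin n × Fin n) × (Fin n × Fin n) → MvPolynomial (Fin n) ℂ := fun q =>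
    .C (ω q.1.1 q.1.2) * (.X q.1.1 * .X q.2.2) - .C (ω q.2.1 q.2.2) * (.X q.2.1 * .X q.1.2)
  have hP : (∏ i, MvPolynomial.X i) * ∏ q ∈ S, P q ≠ 0 := by
    refine mul_ne_zero (Finset.prod_ne_zero_iff.2 fun i _ => MvPolynomial.X_ne_zero i)
      (Finset.prod_ne_zero_iff.2 ?_)
    rintro ⟨⟨i, j⟩, k, l⟩ hq
    obtain ⟨hij, hne⟩ := (Finset.mem_filter.1 hq).2
    exact MvPolynomial.C_mul_X_mul_X_sub_ne_zero (hω0 i j) hij.ne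
      fun hik hlj => hne (Prod.ext hik hlj.symm)
  obtain ⟨a, ha⟩ : ∃ a, MvPolynomial.eval a ((∏ i, MvPolynomial.X i) * ∏ q ∈ S, P q) ≠ 0 := by
    by_contra! h
    exact hP (MvPolynomial.funext fun a => by rw [h a, map_zero])
  simp only [map_mul, map_prod, MvPolynomial.eval_X, mul_ne_zero_iff,
    Finset.prod_ne_zero_iff] at ha
  have ha0 : ∀ i, a i ≠ 0 := fun i => ha.1 i (Finset.mem_univ i)
  refine ⟨a, ha0, fun i j k l hij _ hne heq => ?_⟩
  apply ha.2 ((i, j), (k, l)) (Finset.mem_filter.2 ⟨Finset.mem_univ _, hij, hne⟩)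
  have hj := ha0 j
  have hl := ha0 l
  field_simp at heq
  simp only [P, map_sub, map_mul, MvPolynomial.eval_C, MvPolynomial.eval_X]
  linear_combination heq
end

section
/- The two projections of the multilinearized relation variety coincide as sets: {x ∈ ℂ^n \ {0} : ∃ y ∈ ℂ^n \ {0} with x_j y_i = ω_{ij} x_i y_j for all 1 ≤ i, j ≤ n} = {y ∈ ℂ^n \ {0} : ∃ x ∈ ℂ^n \ {0} with x_j y_i = ω_{ij} x_i y_j for all 1 ≤ i, j ≤ n}. -/
/-- Nonzero solutions of the multilinearized relations have the same support. -/
lemma eq_zero_iff_of_relations {n : ℕ} {ω : Fin n → Fin n → ℂ} {x y : Fin n → ℂ}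
    (hx : x ≠ 0) (hy : y ≠ 0) (h : ∀ i j, x j * y i = ω i j * x i * y j) (i : Fin n) :
    x i = 0 ↔ y i = 0 := by
  constructor
  · intro hxi
    by_contra hyi
    refine hx (funext fun j => ?_)
    have hij := h i j
    simpa [hxi, hyi] using hij
  · intro hyi
    by_contra hxi
    refine hy (funext fun j => ?_)
    have hji := h j i
    simpa [hyi, hxi] using hji

/-- The two projections of the multilinearized relation variety coincide. -/
theorem projections_eq {n : ℕ} (ω : Fin n → Fin n → ℂ)
    (hω0 : ∀ i j, ω i j ≠ 0) (hω1 : ∀ i j, ω i j * ω j i = 1) :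
    {x : Fin n → ℂ | x ≠ 0 ∧ ∃ y : Fin n → ℂ, y ≠ 0 ∧
        ∀ i j, x j * y i = ω i j * x i * y j} =
      {y : Fin n → ℂ | y ≠ 0 ∧ ∃ x : Fin n → ℂ, x ≠ 0 ∧
        ∀ i j, x j * y i = ω i j * x i * y j} := by
  ext v
  constructor
  · rintro ⟨hx, y, hy, h⟩
    have hsupp := eq_zero_iff_of_relations hx hy h
    refine ⟨hx, fun i => v i ^ 2 / y i, fun hz => hx (funext fun i => ?_), fun i j => ?_⟩
    · have hi := congrFun hz i
      simpa [← hsupp i] using hi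
    · by_cases hi : v i = 0
      · simp [hi]
      by_cases hj : v j = 0
      · simp [hj]
      have hyi := mt (hsupp i).2 hi
      have hyj := mt (hsupp j).2 hj
      field_simp
      linear_combination h i j
  · rintro ⟨hy, x, hx, h⟩
    have hsupp := eq_zero_iff_of_relations hx hy h
    refine ⟨hy, fun i => v i ^ 2 / x i, fun hz => hy (funext fun i => ?_), fun i j => ?_⟩
    · have hi := congrFun hz i
      simpa [hsupp i] using hi
    · by_cases hi : v i = 0
      · simp [hi]
      by_cases hj : v j = 0
      · simp [hj]
      have hxi := mt (hsupp i).1 hi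
      have hxj := mt (hsupp j).1 hj
      field_simp
      linear_combination h i j
end

section
/- Let n = 4, let ω be given by ω_{14} = 1/2, ω_{41} = 2, ω_{34} = 4, ω_{43} = 1/4 and ω_{ij} = 1 for all other pairs (i,j), and let ω' be given by ω'_{14} = 1/4, ω'_{41} = 4, ω'_{34} = 1/2, ω'_{43} = 2 and ω'_{ij} = 1 for all other pairs (i,j). Then there do NOT exist a permutation σ ∈ Σ_4 and nonzero complex numbers m_1, m_2, m_3, m_4 such that ω'_{σ(i)σ(j)} = m_i m_j^{-1} ω_{ij} for all i, j ∈ {1,2,3,4}. (Hence the categories Gr(S^4_ω) and Gr(S^4_{ω'}) are not equivalent, even though the corresponding noncommutative projective spaces are birationally equivalent.) -/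
/-- Rescaling by `m i * (m j)⁻¹` does not change the product of the entries along a triangle. -/
theorem triangle_product_eq {ι K : Type*} [Field K] {m : ι → K} (hm : ∀ i, m i ≠ 0)
    {w w' : ι → ι → K} {σ : ι → ι} (h : ∀ i j, w' (σ i) (σ j) = m i * (m j)⁻¹ * w i j)
    (i j k : ι) :
    w' (σ i) (σ j) * w' (σ j) (σ k) * w' (σ k) (σ i) = w i j * w j k * w k i := by
  have hi := hm i
  have hj := hm j
  have hk := hm k
  rw [h, h, h]
  field_simp

/-- For `ω` with `ω_{14} = 1/2`, `ω_{41} = 2`, `ω_{34} = 4`, `ω_{43} = 1/4` (all other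
entries `1`) and `ω'` with `ω'_{14} = 1/4`, `ω'_{41} = 4`, `ω'_{34} = 1/2`,
`ω'_{43} = 2` (all other entries `1`), there are no permutation `σ ∈ Σ_4` and
nonzero `m_1, m_2, m_3, m_4` with `ω'_{σ(i)σ(j)} = m_i m_j⁻¹ ω_{ij}` for all `i, j`.
(Indices `1,2,3,4` are `0,1,2,3`.) -/
theorem no_graded_equivalence (ω ω' : Fin 4 → Fin 4 → ℂ)
    (hω : ω = fun i j =>
      !![(1:ℂ), 1, 1, 1/2; 1, 1, 1, 1; 1, 1, 1, 4; 2, 1, 1/4, 1] i j)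
    (hω' : ω' = fun i j =>
      !![(1:ℂ), 1, 1, 1/4; 1, 1, 1, 1; 1, 1, 1, 1/2; 4, 1, 2, 1] i j) :
    ¬∃ (σ : Equiv.Perm (Fin 4)) (m : Fin 4 → ℂ), (∀ i, m i ≠ 0) ∧
        ∀ i j, ω' (σ i) (σ j) = m i * (m j)⁻¹ * ω i j := by
  subst hω hω'
  rintro ⟨σ, m, hm, h⟩
  have key := triangle_product_eq hm h 0 2 3
  change _ = (1 : ℂ) * 4 * 2 at key
  generalize σ 0 = a, σ 2 = b, σ 3 = c at key
  fin_cases a <;> fin_cases b <;> fin_cases c <;> norm_num at key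
end
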